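/- If G is a simple k-regular graph on a finite vertex set, for some integer k ≥ 2, and 2k−1 does not divide |E(G)|, then the strong chromatic index of G satisfies χ'_s(G) ≥ 2k. -/

import Mathlib

open SimpleGraph Finset

/-- Two edges `e`, `f` of `G` are strongly adjacent if they are distinct and either share an
endpoint, or each shares an endpoint with a common third edge of `G`. -/
def SimpleGraph.StrongAdj {V : Type*} (G : SimpleGraph V) (e f : Sym2 V) : Prop :=
  e ≠ f ∧ ((∃ v, v ∈ e ∧ v ∈ f) ∨
    ∃ h ∈ G.edgeSet, (∃ v, v ∈ e ∧ v ∈ h) ∧ (∃ v, v ∈ h ∧ v ∈ f))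

/-- `φ` is a strong edge-coloring of `G`: strongly adjacent edges get distinct colors. -/
def SimpleGraph.IsStrongEdgeColoring {V : Type*} (G : SimpleGraph V) (φ : Sym2 V → ℕ) : Prop :=
  ∀ e ∈ G.edgeSet, ∀ f ∈ G.edgeSet, G.StrongAdj e f → φ e ≠ φ f

/-- The strong chromatic index of `G`: the least `n` admitting a strong edge-coloring of `G`
using colors `0, …, n-1`. -/
noncomputable def SimpleGraph.strongChromaticIndex {V : Type*} (G : SimpleGraph V) : ℕ :=
  sInf {n | ∃ φ : Sym2 V → ℕ, G.IsStrongEdgeColoring φ ∧ ∀ e ∈ G.edgeSet, φ e < n}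

/-- `G` is `k`-regular: every vertex has exactly `k` neighbors. -/
def SimpleGraph.IsKRegular {V : Type*} (G : SimpleGraph V) (k : ℕ) : Prop :=
  ∀ v : V, (G.neighborSet v).ncard = k

/-- `N(e)`: the set of edges of `G` sharing at least one endpoint with `e`. -/
def SimpleGraph.edgeNbhd {V : Type*} (G : SimpleGraph V) (e : Sym2 V) : Set (Sym2 V) :=
  {f ∈ G.edgeSet | ∃ v, v ∈ e ∧ v ∈ f}

namespace SimpleGraph

variable {V : Type*} {G : SimpleGraph V}

theorem edgeNbhd_mk (a b : V) : G.edgeNbhd s(a, b) = G.incidenceSet a ∪ G.incidenceSet b := by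
  ext f
  simp only [edgeNbhd, incidenceSet, Sym2.mem_iff, Set.mem_ofPred_eq, Set.mem_union]
  grind

theorem mem_edgeNbhd_comm {e f : Sym2 V} (he : e ∈ G.edgeSet) (hf : f ∈ G.edgeSet) :
    f ∈ G.edgeNbhd e ↔ e ∈ G.edgeNbhd f := by
  simp only [edgeNbhd, Set.mem_ofPred_eq, he, hf, true_and, and_comm]

/-- In a `k`-regular graph, every edge meets exactly `2k - 1` edges, itself included. -/
theorem IsKRegular.ncard_edgeNbhd [Finite V] {k : ℕ} (hreg : G.IsKRegular k) {e : Sym2 V}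
    (he : e ∈ G.edgeSet) : (G.edgeNbhd e).ncard = 2 * k - 1 := by
  classical
  have incidence_ncard (v : V) : (G.incidenceSet v).ncard = k := by
    rw [← hreg v, ← Nat.card_coe_set_eq, ← Nat.card_coe_set_eq]
    exact Nat.card_congr (G.incidenceSetEquivNeighborSet v)
  induction e with
  | h a b =>
    have h := Set.ncard_union_add_ncard_inter (G.incidenceSet a) (G.incidenceSet b)
    rw [G.incidenceSet_inter_incidenceSet_of_adj he, Set.ncard_singleton, incidence_ncard,
      incidence_ncard] at h
    rw [edgeNbhd_mk]
    omega

/-- A strong edge-coloring is injective on the edges meeting a given edge. -/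
theorem IsStrongEdgeColoring.injOn_edgeNbhd {φ : Sym2 V → ℕ} (hφ : G.IsStrongEdgeColoring φ)
    {e : Sym2 V} (he : e ∈ G.edgeSet) : Set.InjOn φ (G.edgeNbhd e) := by
  rintro f ⟨hf, u, hue, huf⟩ g ⟨hg, v, hve, hvg⟩ hfg
  by_contra hne
  exact hφ f hf g hg ⟨hne, .inr ⟨e, he, ⟨u, huf, hue⟩, ⟨v, hve, hvg⟩⟩⟩ hfg

/-- With at most `2k - 1` colors, every edge of a `k`-regular graph meets exactly one edge of each
color. -/
theorem IsStrongEdgeColoring.existsUnique_mem_edgeNbhd [Finite V] {k : ℕ}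
    (hreg : G.IsKRegular k) {φ : Sym2 V → ℕ} (hφ : G.IsStrongEdgeColoring φ)
    (hlt : ∀ e ∈ G.edgeSet, φ e < 2 * k - 1) {e : Sym2 V} (he : e ∈ G.edgeSet) {c : ℕ}
    (hc : c < 2 * k - 1) : ∃! f, f ∈ G.edgeNbhd e ∧ φ f = c := by
  have image_eq : φ '' G.edgeNbhd e = Set.Iio (2 * k - 1) := by
    refine Set.eq_of_subset_of_ncard_le ?_ ?_ (Set.finite_Iio _)
    · rintro _ ⟨f, hf, rfl⟩
      exact hlt f hf.1
    · rw [(hφ.injOn_edgeNbhd he).ncard_image, hreg.ncard_edgeNbhd he, ← Finset.coe_Iio,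
        Set.ncard_coe_finset, Nat.card_Iio]
  obtain ⟨f, hf, hfc⟩ : c ∈ φ '' G.edgeNbhd e := image_eq ▸ hc
  exact ⟨f, ⟨hf, hfc⟩, fun g hg => hφ.injOn_edgeNbhd he hg.1 hf (hg.2.trans hfc.symm)⟩

/-- If a `k`-regular graph has a strong edge-coloring with at most `2k - 1` colors, then each of
these colors is used on the same fraction `1 / (2k - 1)` of the edges. -/
theorem IsStrongEdgeColoring.ncard_edgeSet_eq_mul [Finite V] {k : ℕ}
    (hreg : G.IsKRegular k) {φ : Sym2 V → ℕ} (hφ : G.IsStrongEdgeColoring φ)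
    (hlt : ∀ e ∈ G.edgeSet, φ e < 2 * k - 1) {c : ℕ} (hc : c < 2 * k - 1) :
    G.edgeSet.ncard = {f ∈ G.edgeSet | φ f = c}.ncard * (2 * k - 1) := by
  classical
  have := Fintype.ofFinite V
  have h := Finset.card_mul_eq_card_mul (s := G.edgeFinset) (t := {f ∈ G.edgeFinset | φ f = c})
    (fun e f => f ∈ G.edgeNbhd e) (m := 1) (n := 2 * k - 1) ?_ ?_
  · rw [mul_one] at h
    rw [← coe_edgeFinset, Set.ncard_coe_finset, h, ← Set.ncard_coe_finset]
    simp
  · intro e he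
    obtain ⟨f, ⟨hf, hfc⟩, huniq⟩ :=
      hφ.existsUnique_mem_edgeNbhd hreg hlt (mem_edgeFinset.1 he) hc
    refine Finset.card_eq_one.2 ⟨f, ?_⟩
    ext g
    simp only [Finset.mem_bipartiteAbove, Finset.mem_filter, mem_edgeFinset, Finset.mem_singleton]
    constructor
    · rintro ⟨⟨-, hgc⟩, hg⟩
      exact huniq g ⟨hg, hgc⟩
    · rintro rfl
      exact ⟨⟨hf.1, hfc⟩, hf⟩
  · intro f hf
    have hfE := mem_edgeFinset.1 (Finset.mem_filter.1 hf).1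
    rw [← hreg.ncard_edgeNbhd hfE, ← Set.ncard_coe_finset]
    congr 1
    ext e
    simp only [Finset.coe_bipartiteBelow, Set.mem_ofPred_eq, mem_edgeFinset]
    exact ⟨fun h => (mem_edgeNbhd_comm h.1 hfE).1 h.2,
      fun h => ⟨h.1, (mem_edgeNbhd_comm h.1 hfE).2 h⟩⟩

/-- The infimum defining the strong chromatic index of a finite graph is attained. -/
theorem exists_isStrongEdgeColoring_lt_strongChromaticIndex [Finite V] (G : SimpleGraph V) :
    ∃ φ : Sym2 V → ℕ, G.IsStrongEdgeColoring φ ∧ ∀ e ∈ G.edgeSet, φ e < G.strongChromaticIndex := by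
  obtain ⟨n, ⟨equiv⟩⟩ := Finite.exists_equiv_fin (Sym2 V)
  exact Nat.sInf_mem (s := {n | ∃ φ : Sym2 V → ℕ,
    G.IsStrongEdgeColoring φ ∧ ∀ e ∈ G.edgeSet, φ e < n}) ⟨n, fun e => equiv e,
    fun e _ f _ hef h => hef.1 (equiv.injective (Fin.ext h)), fun e _ => (equiv e).isLt⟩

end SimpleGraph

/-- If `G` is a finite simple `k`-regular graph (`k ≥ 2`) and `2k-1` does not divide
`|E(G)|`, then `χ'ₛ(G) ≥ 2k`. -/
theorem stmt3 {V : Type*} [Fintype V] (k : ℕ) (hk : 2 ≤ k) (G : SimpleGraph V)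
    (hreg : G.IsKRegular k) (hdvd : ¬ (2 * k - 1) ∣ G.edgeSet.ncard) :
    2 * k ≤ G.strongChromaticIndex := by
  by_contra! hlt
  obtain ⟨φ, hφ, hφlt⟩ := G.exists_isStrongEdgeColoring_lt_strongChromaticIndex
  refine hdvd (Dvd.intro_left _
    (hφ.ncard_edgeSet_eq_mul hreg (fun e he => ?_) (c := 0) (by omega)).symm)
  have := hφlt e he
  omega
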